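/- arXiv:2510.22186 — 2 statements merged into one kernel-verified Lean document; each statement's English description precedes it below -/
import Mathlib

section
/- Let n, d, D, M be natural numbers with D ≥ n(d−1)+1 and M ≥ (2n−1)d, and let A ∈ ℝ^{d×D} be a full spark matrix. Then the set of linear maps L : ℝ^{n×D} → ℝ^M (identified with ℝ^{M×(nD)}) for which the composition L ∘ β_A fails to separate S_n-orbits (i.e., for which there exist X, Y ∈ ℝ^{n×d} with L(β_A(X)) = L(β_A(Y)) but X ≠ σY for every σ ∈ S_n) has Lebesgue measure zero in ℝ^{M×(nD)}. -/
open Matrix MeasureTheory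

/-- `sortVec v` rearranges the entries of `v` in non-decreasing order. -/
noncomputable def sortVec {n : ℕ} (v : Fin n → ℝ) : Fin n → ℝ := v ∘ Tuple.sort v

/-- The sorting-based embedding `β_A`: the `k`-th column of `β_A X` is `sort (X a_k)`,
where `a_k` is the `k`-th column of `A`. -/
noncomputable def betaEmb {n d D : ℕ} (A : Matrix (Fin d) (Fin D) ℝ)
    (X : Matrix (Fin n) (Fin d) ℝ) : Matrix (Fin n) (Fin D) ℝ :=
  Matrix.of fun i k => sortVec (X.mulVec fun l => A l k) i

/-- Frobenius norm of a real matrix. -/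
noncomputable def frob {n m : ℕ} (M : Matrix (Fin n) (Fin m) ℝ) : ℝ :=
  Real.sqrt (∑ i, ∑ j, (M i j) ^ 2)

/-- `dist(X,Y) = min_{σ ∈ S_n} ‖X - σY‖_F`, where `σ` acts by permuting rows. -/
noncomputable def permDist {n d : ℕ} (X Y : Matrix (Fin n) (Fin d) ℝ) : ℝ :=
  ⨅ σ : Equiv.Perm (Fin n), frob (X - Y.submatrix σ id)

/-- A wide matrix has full spark if every `d` of its columns are linearly independent. -/
def FullSpark {d D : ℕ} (A : Matrix (Fin d) (Fin D) ℝ) : Prop :=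
  ∀ f : Fin d → Fin D, Function.Injective f →
    LinearIndependent ℝ (fun i : Fin d => fun l : Fin d => A l (f i))

/-- Flattening of an `n × D` matrix into a vector in `ℝ^{nD}`. -/
noncomputable def vecM {n D : ℕ} (M : Matrix (Fin n) (Fin D) ℝ) : Fin (n * D) → ℝ :=
  fun p => M (finProdFinEquiv.symm p).1 (finProdFinEquiv.symm p).2

/-- Two families with the same multiset of values differ by a permutation of the indices. -/
lemma exists_perm_of_map_univ_eq {α : Type*} {n : ℕ} {f g : Fin n → α}
    (h : Finset.univ.val.map f = Finset.univ.val.map g) :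
    ∃ σ : Equiv.Perm (Fin n), ∀ i, f i = g (σ i) := by
  classical
  have hc : ∀ c, Nonempty ({i // f i = c} ≃ {j // g j = c}) := by
    intro c
    have := congrArg (Multiset.count c) h
    rw [Multiset.count_map, Multiset.count_map] at this
    refine ⟨Fintype.equivOfCardEq ?_⟩
    rw [Fintype.card_subtype, Fintype.card_subtype]
    simpa only [eq_comm, Finset.card_def, Finset.filter_val] using this
  exact ⟨Equiv.ofFiberEquiv fun c => (hc c).some, fun i => (Equiv.ofFiberEquiv_map _ i).symm⟩

lemma map_univ_sortVec {n : ℕ} (v : Fin n → ℝ) :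
    Finset.univ.val.map (sortVec v) = Finset.univ.val.map v := by
  rw [sortVec, ← Multiset.map_map, Multiset.map_univ_val_equiv]

lemma FullSpark.eq_of_card_le {d D : ℕ} {A : Matrix (Fin d) (Fin D) ℝ} (hA : FullSpark A)
    {x y : Fin d → ℝ} {s : Finset (Fin D)} (hs : d ≤ s.card)
    (h : ∀ k ∈ s, (x ⬝ᵥ fun l => A l k) = y ⬝ᵥ fun l => A l k) : x = y := by
  obtain ⟨t, hts, ht⟩ := Finset.exists_subset_card_eq hs
  have hli := hA (t.orderEmbOfFin ht) (t.orderEmbOfFin ht).injective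
  have hspan := hli.span_eq_top_of_card_eq_finrank' (by simp)
  have hz : ∀ w : Fin d → ℝ, (x - y) ⬝ᵥ w = 0 := by
    intro w
    have hw : w ∈ Submodule.span ℝ
        (Set.range fun i : Fin d => fun l : Fin d => A l (t.orderEmbOfFin ht i)) := by
      rw [hspan]; trivial
    induction hw using Submodule.span_induction with
    | mem w hw =>
      obtain ⟨i, rfl⟩ := hw
      rw [sub_dotProduct, h _ (hts (t.orderEmbOfFin_mem ht i)), sub_self]
    | zero => simp
    | add a b _ _ ha hb => rw [dotProduct_add, ha, hb, add_zero]
    | smul c a _ ha => rw [dotProduct_smul, ha, smul_zero]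
  exact sub_eq_zero.1 (dotProduct_self_eq_zero.1 (hz _))

/-- A multiset of `m` vectors is determined by its projections onto `m * (d - 1) + 1` columns
of a full spark matrix. -/
lemma FullSpark.multiset_eq {d D : ℕ} {A : Matrix (Fin d) (Fin D) ℝ} (hA : FullSpark A)
    (s t : Multiset (Fin d → ℝ)) (hst : s.card = t.card) (hD : s.card * (d - 1) + 1 ≤ D)
    (h : ∀ k, s.map (fun x => x ⬝ᵥ fun l => A l k) = t.map (fun x => x ⬝ᵥ fun l => A l k)) :
    s = t := by
  classical
  induction s using Multiset.induction generalizing t with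
  | empty => exact (Multiset.card_eq_zero.1 hst.symm).symm
  | cons x s ih =>
    have hmem : ∀ k, ∃ y ∈ t, (y ⬝ᵥ fun l => A l k) = x ⬝ᵥ fun l => A l k := fun k => by
      rw [← Multiset.mem_map, ← h k]
      exact Multiset.mem_map_of_mem _ (Multiset.mem_cons_self x s)
    choose y hyt hy using hmem
    have hcard : t.toFinset.card * (d - 1) < (Finset.univ : Finset (Fin D)).card := by
      have := Nat.mul_le_mul_right (d - 1) (t.toFinset_card_le.trans hst.ge)
      rw [Finset.card_fin]
      omega
    obtain ⟨z, hz, hlt⟩ := Finset.exists_lt_card_fiber_of_mul_lt_card_of_maps_to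
      (f := y) (fun k _ => Multiset.mem_toFinset.2 (hyt k)) hcard
    have hxz : x = z := by
      refine hA.eq_of_card_le (Nat.le_of_pred_lt hlt) fun k hk => ?_
      rw [← (Finset.mem_filter.1 hk).2, hy]
    subst hxz
    obtain ⟨t, rfl⟩ := Multiset.exists_cons_of_mem (Multiset.mem_toFinset.1 hz)
    congr 1
    refine ih t (by simpa using hst) ?_ fun k => by simpa using h k
    rw [Multiset.card_cons, Nat.succ_mul] at hD
    omega

/-- The sorting-based embedding of a full spark matrix with enough columns separates orbits. -/
lemma FullSpark.exists_perm_of_betaEmb_eq {n d D : ℕ} (hD : n * (d - 1) + 1 ≤ D)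
    {A : Matrix (Fin d) (Fin D) ℝ} (hA : FullSpark A) {X Y : Matrix (Fin n) (Fin d) ℝ}
    (h : betaEmb A X = betaEmb A Y) : ∃ σ : Equiv.Perm (Fin n), X = Y.submatrix σ id := by
  have key : (Finset.univ.val.map fun i => X i) = Finset.univ.val.map fun i => Y i := by
    refine hA.multiset_eq _ _ (by simp) (by simpa using hD) fun k => ?_
    have hk : sortVec (X.mulVec fun l => A l k) = sortVec (Y.mulVec fun l => A l k) :=
      funext fun i => congrFun (congrFun h i) k
    have := congrArg (Finset.univ.val.map) hk
    rw [map_univ_sortVec, map_univ_sortVec] at this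
    rw [Multiset.map_map, Multiset.map_map]
    exact this
  obtain ⟨σ, hσ⟩ := exists_perm_of_map_univ_eq key
  exact ⟨σ, funext hσ⟩

lemma vecM_injective {n D : ℕ} :
    Function.Injective (vecM : Matrix (Fin n) (Fin D) ℝ → Fin (n * D) → ℝ) := by
  intro P Q h
  ext i k
  simpa [vecM] using congrFun h (finProdFinEquiv (i, k))

/-- The linear map sending `(X, Y)` to the matrix with `k`-th column `σ_k X a_k - τ_k Y a_k`,
flattened. -/
def permDiff {n d D : ℕ} (A : Matrix (Fin d) (Fin D) ℝ) (σ τ : Fin D → Equiv.Perm (Fin n)) :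
    (Fin n → Fin d → ℝ) × (Fin n → Fin d → ℝ) →ₗ[ℝ] (Fin (n * D) → ℝ) where
  toFun Z p := (Z.1 (σ p.modNat p.divNat) ⬝ᵥ fun l => A l p.modNat) -
    Z.2 (τ p.modNat p.divNat) ⬝ᵥ fun l => A l p.modNat
  map_add' Z W := by
    ext p
    simp only [Prod.fst_add, Prod.snd_add, Pi.add_apply, add_dotProduct]
    ring
  map_smul' c Z := by
    ext p
    simp only [Prod.smul_fst, Prod.smul_snd, Pi.smul_apply, smul_dotProduct, RingHom.id_apply,
      smul_sub]

lemma exists_vecM_betaEmb_sub_eq {n d D : ℕ} (A : Matrix (Fin d) (Fin D) ℝ)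
    (X Y : Matrix (Fin n) (Fin d) ℝ) :
    ∃ σ τ : Fin D → Equiv.Perm (Fin n),
      vecM (betaEmb A X) - vecM (betaEmb A Y) = permDiff A σ τ (X, Y) :=
  ⟨fun k => Tuple.sort (X.mulVec fun l => A l k), fun k => Tuple.sort (Y.mulVec fun l => A l k),
    rfl⟩

lemma finrank_range_permDiff_le {n d D : ℕ} (hn : 0 < n) (A : Matrix (Fin d) (Fin D) ℝ)
    (σ τ : Fin D → Equiv.Perm (Fin n)) :
    Module.finrank ℝ (LinearMap.range (permDiff A σ τ)) ≤ (2 * n - 1) * d := by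
  let c : (Fin d → ℝ) →ₗ[ℝ] (Fin n → Fin d → ℝ) × (Fin n → Fin d → ℝ) :=
    { toFun := fun v => (fun _ => v, fun _ => v)
      map_add' := fun _ _ => rfl
      map_smul' := fun _ _ => rfl }
  have hc : Function.Injective c := fun v w h => congrFun (congrArg Prod.fst h) ⟨0, hn⟩
  have hle : LinearMap.range c ≤ LinearMap.ker (permDiff A σ τ) := by
    rintro _ ⟨v, rfl⟩
    exact funext fun p => sub_self _
  have h1 := Submodule.finrank_mono hle
  rw [LinearMap.finrank_range_of_inj hc, Module.finrank_fin_fun] at h1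
  have h2 := (permDiff A σ τ).finrank_range_add_finrank_ker
  rw [Module.finrank_prod, Module.finrank_pi_fintype] at h2
  simp only [Module.finrank_fin_fun, Finset.sum_const, Finset.card_univ, Fintype.card_fin,
    smul_eq_mul] at h2
  rw [Nat.sub_mul, mul_assoc, two_mul, one_mul]
  omega

/-- The maps `ℝ^N → ℝ^M` whose kernel meets the subspace `V` nontrivially. -/
def singularOn {N : ℕ} (M : ℕ) (V : Submodule ℝ (Fin N → ℝ)) : Set (Fin M → Fin N → ℝ) :=
  {L | ∃ v ∈ V, v ≠ 0 ∧ ∀ i, L i ⬝ᵥ v = 0}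

lemma isClosed_singularOn {N : ℕ} (M : ℕ) (V : Submodule ℝ (Fin N → ℝ)) :
    IsClosed (singularOn M V) := by
  let b := Module.finBasis ℝ V
  let F : (Fin M → Fin N → ℝ) → Fin (Module.finrank ℝ V) → Fin M → ℝ :=
    fun L j => (Matrix.of L).mulVec (b j : Fin N → ℝ)
  have hF : Continuous F := by
    refine continuous_pi fun j => continuous_pi fun i => ?_
    simp only [F, Matrix.mulVec, dotProduct, Matrix.of_apply]
    fun_prop
  have heq : singularOn M V = (F ⁻¹' {f | LinearIndependent ℝ f})ᶜ := by
    ext L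
    have hlin : F L = ((Matrix.of L).mulVecLin ∘ₗ V.subtype) ∘ b := rfl
    have hiff : LinearIndependent ℝ (F L) ↔
        LinearMap.ker ((Matrix.of L).mulVecLin ∘ₗ V.subtype) = ⊥ := by
      rw [hlin]
      constructor
      · intro h
        exact LinearMap.ker_eq_bot.2 (LinearMap.injective_of_linearIndependent b.span_eq h)
      · intro h
        exact b.linearIndependent.map' _ h
    rw [Set.mem_compl_iff, Set.mem_preimage, Set.mem_ofPred_eq, hiff, LinearMap.ker_eq_bot']
    push Not
    constructor
    · rintro ⟨v, hv, hv0, h⟩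
      exact ⟨⟨v, hv⟩, funext h, fun h0 => hv0 (congrArg Subtype.val h0)⟩
    · rintro ⟨v, h, hv0⟩
      exact ⟨v, v.2, fun h0 => hv0 (Subtype.ext h0), fun i => congrFun h i⟩
  rw [heq]
  exact (isOpen_setOfPred_linearIndependent.preimage hF).isClosed_compl

/-- Almost every linear map into `ℝ^M` is injective on a given subspace of dimension at
most `M`. -/
lemma measure_singularOn {N M : ℕ} (V : Submodule ℝ (Fin N → ℝ)) (hV : Module.finrank ℝ V ≤ M) :
    (Measure.pi fun _ : Fin M => (Measure.pi fun _ : Fin N => (volume : Measure ℝ)))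
      (singularOn M V) = 0 := by
  induction M generalizing V with
  | zero =>
    have hbot : V = ⊥ := Submodule.finrank_eq_zero.1 (Nat.le_zero.1 hV)
    refine measure_mono_null ?_ measure_empty
    rintro L ⟨v, hv, hv0, -⟩
    exact hv0 (by simpa [hbot] using hv)
  | succ M ih =>
    set μ := Measure.pi fun _ : Fin N => (volume : Measure ℝ)
    by_cases hbot : V = ⊥
    · refine measure_mono_null ?_ measure_empty
      rintro L ⟨v, hv, hv0, -⟩
      exact hv0 (by simpa [hbot] using hv)
    obtain ⟨w, hwV, hw0⟩ := V.ne_bot_iff.1 hbot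
    have hmp := (measurePreserving_piFinSuccAbove (fun _ : Fin (M + 1) => μ) 0).symm
    have hmeas := (isClosed_singularOn (M + 1) V).measurableSet
    rw [← hmp.measure_preimage hmeas.nullMeasurableSet]
    refine Measure.measure_prod_null_of_ae_null (hmp.measurable hmeas) ?_
    let H : Submodule ℝ (Fin N → ℝ) := LinearMap.ker (dotProductBilin ℝ ℝ w)
    have hH : μ H = 0 := by
      refine Measure.addHaar_submodule μ H fun h => hw0 ?_
      have : w ∈ H := h ▸ Submodule.mem_top
      exact dotProduct_self_eq_zero.1 this
    filter_upwards [measure_eq_zero_iff_ae_notMem.1 hH] with l hl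
    let K : Submodule ℝ (Fin N → ℝ) := LinearMap.ker (dotProductBilin ℝ ℝ l)
    have hlt : V ⊓ K < V := by
      refine lt_of_le_of_ne inf_le_left fun h => hl ?_
      have : w ∈ K := (inf_eq_left.1 h) hwV
      exact (dotProduct_comm w l).trans this
    refine measure_mono_null ?_ (ih (V ⊓ K)
      (Nat.le_of_lt_succ ((Submodule.finrank_lt_finrank_of_lt hlt).trans_le hV)))
    rintro L ⟨v, hv, hv0, h⟩
    exact ⟨v, ⟨hv, h 0⟩, hv0, fun i => h i.succ⟩

/-- If `D ≥ n(d-1)+1`, `M ≥ (2n-1)d` and `A` has full spark, then the set of linear maps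
`L : ℝ^{n×D} → ℝ^M` for which `L ∘ β_A` fails to separate `S_n`-orbits has Lebesgue
measure zero in `ℝ^{M×(nD)}`. -/
theorem stmt3 (n d D M : ℕ) (hD : D ≥ n * (d - 1) + 1) (hM : M ≥ (2 * n - 1) * d)
    (A : Matrix (Fin d) (Fin D) ℝ) (hA : FullSpark A) :
    (Measure.pi fun _ : Fin M => Measure.pi fun _ : Fin (n * D) => (volume : Measure ℝ))
      {L : Fin M → Fin (n * D) → ℝ |
        ∃ X Y : Matrix (Fin n) (Fin d) ℝ,
          (Matrix.of L).mulVec (vecM (betaEmb A X)) = (Matrix.of L).mulVec (vecM (betaEmb A Y)) ∧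
          ∀ σ : Equiv.Perm (Fin n), X ≠ Y.submatrix σ id} = 0 := by
  rcases Nat.eq_zero_or_pos n with rfl | hn
  · refine measure_mono_null ?_ measure_empty
    rintro L ⟨X, Y, -, h⟩
    exact h 1 (Subsingleton.elim _ _)
  refine measure_mono_null (t := ⋃ σ : Fin D → Equiv.Perm (Fin n),
    ⋃ τ : Fin D → Equiv.Perm (Fin n), singularOn M (LinearMap.range (permDiff A σ τ))) ?_ ?_
  · rintro L ⟨X, Y, hL, hXY⟩
    obtain ⟨σ, τ, h⟩ := exists_vecM_betaEmb_sub_eq A X Y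
    refine Set.mem_iUnion₂.2 ⟨σ, τ, _, ⟨(X, Y), h.symm⟩, fun h0 => ?_, fun i => ?_⟩
    · obtain ⟨ρ, hρ⟩ := hA.exists_perm_of_betaEmb_eq hD (vecM_injective (sub_eq_zero.1 h0))
      exact hXY ρ hρ
    · rw [dotProduct_sub, sub_eq_zero]
      exact congrFun hL i
  · exact measure_iUnion_null fun σ => measure_iUnion_null fun τ =>
      measure_singularOn _ ((finrank_range_permDiff_le hn A σ τ).trans hM)
end

section
/- Let d, n, D be natural numbers, let δ > 0, and let m ∈ [D] satisfy n²(m−1) ≤ D. Suppose A ∈ ℝ^{d×D}, with columns a_1,…,a_D, has (m,δ)-projective uniformity, i.e., for every unit vector e ∈ S^{d−1} at most m−1 of the indices k ∈ [D] satisfy |a_kᵀ e| < δ. Then for all X, Y ∈ ℝ^{n×d}, ‖β_A(X) − β_A(Y)‖_F ≥ δ·√(D − n²(m−1)) · dist(X,Y). -/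
open Matrix MeasureTheory

lemma frob_nonneg {n m : ℕ} (M : Matrix (Fin n) (Fin m) ℝ) : 0 ≤ frob M :=
  Real.sqrt_nonneg _

lemma frob_sq {n m : ℕ} (M : Matrix (Fin n) (Fin m) ℝ) :
    frob M ^ 2 = ∑ i, ∑ j, (M i j) ^ 2 :=
  Real.sq_sqrt (by positivity)

lemma permDist_nonneg {n d : ℕ} (X Y : Matrix (Fin n) (Fin d) ℝ) : 0 ≤ permDist X Y :=
  Real.iInf_nonneg fun _ => frob_nonneg _

lemma permDist_sq_le {n d : ℕ} (X Y : Matrix (Fin n) (Fin d) ℝ) (σ : Equiv.Perm (Fin n)) :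
    permDist X Y ^ 2 ≤ ∑ i, ∑ l, (X i l - Y (σ i) l) ^ 2 := by
  have h : permDist X Y ≤ frob (X - Y.submatrix σ id) :=
    ciInf_le (Set.finite_range _).bddBelow σ
  calc permDist X Y ^ 2 ≤ frob (X - Y.submatrix σ id) ^ 2 :=
        pow_le_pow_left₀ (permDist_nonneg X Y) h 2
    _ = _ := by simp [frob_sq]

/-- The sorted vectors differ as the original ones do under a suitable matching. -/
lemma exists_perm_sum_sortVec_sub_sq {n : ℕ} (u v : Fin n → ℝ) :
    ∃ σ : Equiv.Perm (Fin n),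
      ∑ i, (sortVec u i - sortVec v i) ^ 2 = ∑ i, (u i - v (σ i)) ^ 2 := by
  refine ⟨(Tuple.sort u).symm.trans (Tuple.sort v), ?_⟩
  rw [← Equiv.sum_comp (Tuple.sort u) fun i => (u i - v _) ^ 2]
  simp [sortVec]

/-- Projective uniformity, rescaled from unit vectors to arbitrary ones. -/
lemma ncard_abs_sum_lt_le {d D : ℕ} {δ : ℝ} {m : ℕ} {A : Matrix (Fin d) (Fin D) ℝ}
    (hA : ∀ e : Fin d → ℝ, ∑ i, e i ^ 2 = 1 →
      Set.ncard {k : Fin D | |∑ i, A i k * e i| < δ} ≤ m)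
    (w : Fin d → ℝ) :
    Set.ncard {k : Fin D | |∑ i, A i k * w i| < δ * √(∑ i, w i ^ 2)} ≤ m := by
  rcases (Real.sqrt_nonneg (∑ i, w i ^ 2)).eq_or_lt with h | h
  · simp [← h, (abs_nonneg _).not_gt]
  · have hw := Real.sq_sqrt (show 0 ≤ ∑ i, w i ^ 2 by positivity)
    set r := √(∑ i, w i ^ 2)
    have hunit : ∑ i, (w i / r) ^ 2 = 1 := by
      simp_rw [div_pow]
      rw [← Finset.sum_div, ← hw, div_self (by positivity)]
    have hscale : ∀ k, |∑ i, A i k * (w i / r)| < δ ↔ |∑ i, A i k * w i| < δ * r := fun k => by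
      simp_rw [← mul_div_assoc]
      rw [← Finset.sum_div, abs_div, abs_of_pos h, div_lt_iff₀ h]
    simpa only [hscale] using hA (fun i => w i / r) hunit

/-- A column along which no difference of rows is nearly annihilated contributes at least
`δ² dist²`. -/
lemma sq_mul_permDist_sq_le {n d D : ℕ} {δ : ℝ} (hδ : 0 < δ) (A : Matrix (Fin d) (Fin D) ℝ)
    (X Y : Matrix (Fin n) (Fin d) ℝ) (k : Fin D)
    (hk : ∀ i j, δ * √(∑ l, (X i l - Y j l) ^ 2) ≤ |∑ l, A l k * (X i l - Y j l)|) :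
    δ ^ 2 * permDist X Y ^ 2 ≤ ∑ i, (betaEmb A X i k - betaEmb A Y i k) ^ 2 := by
  obtain ⟨σ, hσ⟩ := exists_perm_sum_sortVec_sub_sq
    (X.mulVec fun l => A l k) (Y.mulVec fun l => A l k)
  simp only [betaEmb, Matrix.of_apply]
  rw [hσ]
  calc δ ^ 2 * permDist X Y ^ 2 ≤ δ ^ 2 * ∑ i, ∑ l, (X i l - Y (σ i) l) ^ 2 := by
        gcongr
        exact permDist_sq_le X Y σ
    _ = ∑ i, (δ * √(∑ l, (X i l - Y (σ i) l) ^ 2)) ^ 2 := by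
        rw [Finset.mul_sum]
        refine Finset.sum_congr rfl fun i _ => ?_
        rw [mul_pow, Real.sq_sqrt (by positivity)]
    _ ≤ _ := by
        refine Finset.sum_le_sum fun i _ => ?_
        have h : (X.mulVec fun l => A l k) i - (Y.mulVec fun l => A l k) (σ i) =
            ∑ l, A l k * (X i l - Y (σ i) l) := by
          simp only [Matrix.mulVec, dotProduct, ← Finset.sum_sub_distrib]
          exact Finset.sum_congr rfl fun l _ => by ring
        rw [h, ← sq_abs (∑ l, A l k * (X i l - Y (σ i) l))]
        exact pow_le_pow_left₀ (by positivity) (hk i (σ i)) 2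

/-- If `A` has `(m,δ)`-projective uniformity and `n²(m-1) ≤ D`, then the lower Lipschitz
constant of `β_A` is at least `δ·√(D - n²(m-1))`. -/
theorem stmt5 (d n D : ℕ) (δ : ℝ) (hδ : 0 < δ) (m : ℕ) (hm : 1 ≤ m) (hmD : m ≤ D)
    (hn : n ^ 2 * (m - 1) ≤ D)
    (A : Matrix (Fin d) (Fin D) ℝ)
    (hA : ∀ e : Fin d → ℝ, ∑ i, e i ^ 2 = 1 →
      Set.ncard {k : Fin D | |∑ i, A i k * e i| < δ} ≤ m - 1)
    (X Y : Matrix (Fin n) (Fin d) ℝ) :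
    frob (betaEmb A X - betaEmb A Y) ≥
      δ * Real.sqrt ((D : ℝ) - (n : ℝ) ^ 2 * ((m : ℝ) - 1)) * permDist X Y := by
  classical
  let B : Fin n × Fin n → Finset (Fin D) := fun p =>
    {k | |∑ l, A l k * (X p.1 l - Y p.2 l)| < δ * √(∑ l, (X p.1 l - Y p.2 l) ^ 2)}
  let bad := Finset.univ.biUnion B
  have hB : ∀ p, (B p).card ≤ m - 1 := fun p => by
    rw [← Set.ncard_coe_finset]
    simpa [B] using ncard_abs_sum_lt_le hA fun l => X p.1 l - Y p.2 l
  have hbad : bad.card ≤ n ^ 2 * (m - 1) := by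
    simpa [sq] using Finset.card_biUnion_le_card_mul Finset.univ B (m - 1) fun p _ => hB p
  have hcast : (n : ℝ) ^ 2 * ((m : ℝ) - 1) = ((n ^ 2 * (m - 1) : ℕ) : ℝ) := by
    push_cast [Nat.cast_sub hm]
    rfl
  have hgood : (D : ℝ) - (n : ℝ) ^ 2 * ((m : ℝ) - 1) ≤ (badᶜ.card : ℝ) := by
    rw [hcast, sub_le_iff_le_add]
    have h := Finset.card_add_card_compl bad
    rw [Fintype.card_fin] at h
    exact_mod_cast (by omega : D ≤ badᶜ.card + n ^ 2 * (m - 1))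
  have hpos : 0 ≤ (D : ℝ) - (n : ℝ) ^ 2 * ((m : ℝ) - 1) := by
    rw [hcast, sub_nonneg]
    exact_mod_cast hn
  refine le_of_sq_le_sq ?_ (frob_nonneg _)
  rw [frob_sq, Finset.sum_comm, mul_pow, mul_pow, Real.sq_sqrt hpos]
  calc δ ^ 2 * ((D : ℝ) - (n : ℝ) ^ 2 * ((m : ℝ) - 1)) * permDist X Y ^ 2
      ≤ δ ^ 2 * (badᶜ.card : ℝ) * permDist X Y ^ 2 := by gcongr
    _ = ∑ _k ∈ badᶜ, δ ^ 2 * permDist X Y ^ 2 := by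
        rw [Finset.sum_const, nsmul_eq_mul]
        ring
    _ ≤ ∑ k ∈ badᶜ, ∑ i, (betaEmb A X i k - betaEmb A Y i k) ^ 2 := by
        refine Finset.sum_le_sum fun k hk => sq_mul_permDist_sq_le hδ A X Y k fun i j => ?_
        simp only [bad, B, Finset.mem_compl, Finset.mem_biUnion, Finset.mem_univ, true_and,
          Finset.mem_filter, not_exists, not_lt] at hk
        exact hk (i, j)
    _ ≤ ∑ k, ∑ i, (betaEmb A X i k - betaEmb A Y i k) ^ 2 :=
        Finset.sum_le_sum_of_subset_of_nonneg (Finset.subset_univ _)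
          fun _ _ _ => by positivity
    _ = _ := rfl
end
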